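/- Assume m ≥ 2, ‖z̄ − h̄‖₂ ≤ δ√n for some δ ∈ [0,1], and λ < 1/(2((2k+1)^d − 1)). Then (TRS) has a unique global minimizer ĝ, and it satisfies (1/n)⟨h̄, ĝ⟩ ≥ 1 − 3δ/2 − λπ²M²(2k)^{2α}·d^{2α}·((2k+1)^d − 1)/n^{2α/d}. -/

import Mathlib

open scoped BigOperators
noncomputable section

namespace ModOneMulti

/-- Index set of the `d`-dimensional grid: `V = {1,…,m}^d`. -/
abbrev V (d m : ℕ) := Fin d → Fin m

/-- Grid point `x_𝐢 ∈ [0,1]^d` indexed by `𝐢 ∈ V`. -/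
def gridPt (d m : ℕ) (i : V d m) : Fin d → ℝ := fun t => (i t : ℝ) / ((m : ℝ) - 1)

/-- Adjacency: `𝐢 ≠ 𝐣` and `‖𝐢 − 𝐣‖_∞ ≤ k`. -/
def adj (d m k : ℕ) (i j : V d m) : Prop :=
  i ≠ j ∧ ∀ t, |(i t : ℤ) - (j t : ℤ)| ≤ (k : ℤ)

instance adjDec (d m k : ℕ) (i : V d m) : DecidablePred (adj d m k i) := fun j =>
  inferInstanceAs (Decidable (i ≠ j ∧ ∀ t, |(i t : ℤ) - (j t : ℤ)| ≤ (k : ℤ)))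

/-- Degree of vertex `𝐢` in the graph `G`. -/
def deg (d m k : ℕ) (i : V d m) : ℕ := (Finset.univ.filter (adj d m k i)).card

/-- The graph Laplacian `L` of `G`. -/
def lap (d m k : ℕ) : Matrix (V d m) (V d m) ℝ := fun i j =>
  if i = j then (deg d m k i : ℝ) else if adj d m k i j then -1 else 0

/-- The block-diagonal matrix `H` with both diagonal blocks equal to `λL`. -/
def Hmat (d m k : ℕ) (lam : ℝ) : Matrix (V d m ⊕ V d m) (V d m ⊕ V d m) ℝ :=
  Matrix.fromBlocks (lam • lap d m k) 0 0 (lam • lap d m k)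

/-- The angular embedding `circ t = exp(2πι t)`. -/
def circ (t : ℝ) : ℂ := Complex.exp (2 * Real.pi * Complex.I * (t : ℂ))

/-- Real representation `(Re v, Im v) ∈ ℝ^{2n}` of a complex vector `v ∈ ℂ^n`. -/
def embed (d m : ℕ) (v : V d m → ℂ) : V d m ⊕ V d m → ℝ :=
  Sum.elim (fun i => (v i).re) (fun i => (v i).im)

/-- Real representation of the angular embedding of values `t : V → ℝ`. -/
def cvec (d m : ℕ) (t : V d m → ℝ) : V d m ⊕ V d m → ℝ := embed d m (fun i => circ (t i))

/-- Quadratic form `vᵀ A v`. -/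
def quad (d m : ℕ) (A : Matrix (V d m ⊕ V d m) (V d m ⊕ V d m) ℝ)
    (v : V d m ⊕ V d m → ℝ) : ℝ := ∑ i, v i * A.mulVec v i

/-- Euclidean inner product on `ℝ^{2n}`. -/
def dotR (d m : ℕ) (u v : V d m ⊕ V d m → ℝ) : ℝ := ∑ i, u i * v i

/-- Euclidean norm on `ℝ^{2n}`. -/
def norm2 (d m : ℕ) (v : V d m ⊕ V d m → ℝ) : ℝ := Real.sqrt (∑ i, (v i) ^ 2)

/-- Feasibility for (TRS): `‖g‖₂² = n` with `n = m^d`. -/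
def feasible (d m : ℕ) (g : V d m ⊕ V d m → ℝ) : Prop := ∑ i, (g i) ^ 2 = ((m : ℝ)) ^ d

/-- The (TRS) objective `ḡᵀHḡ − 2ḡᵀz̄`. -/
def objective (d m k : ℕ) (lam : ℝ) (zbar g : V d m ⊕ V d m → ℝ) : ℝ :=
  quad d m (Hmat d m k lam) g - 2 * dotR d m g zbar

/-- `g` is a global minimizer of (TRS) with data `z̄`. -/
def minimizer (d m k : ℕ) (lam : ℝ) (zbar g : V d m ⊕ V d m → ℝ) : Prop :=
  feasible d m g ∧
    ∀ g', feasible d m g' → objective d m k lam zbar g ≤ objective d m k lam zbar g'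

/-- `z̄` is orthogonal to the null space `N(H)` of `H`. -/
def perpNull (d m k : ℕ) (lam : ℝ) (z : V d m ⊕ V d m → ℝ) : Prop :=
  ∀ v, (Hmat d m k lam).mulVec v = 0 → dotR d m z v = 0

/-- Euclidean norm on `ℝ^d`. -/
def enorm (d : ℕ) (x : Fin d → ℝ) : ℝ := Real.sqrt (∑ t, (x t) ^ 2)

end ModOneMulti

namespace Matrix

variable {ι : Type*} [Fintype ι]

/-- The trust-region objective `vᵀAv - 2 vᵀz`. -/
def trsObj (A : Matrix ι ι ℝ) (z v : ι → ℝ) : ℝ := v ⬝ᵥ A *ᵥ v - 2 * (v ⬝ᵥ z)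

lemma trsObj_add_smul {A : Matrix ι ι ℝ} (hA : A.IsSymm) (z v w : ι → ℝ) (t : ℝ) :
    trsObj A z (v + t • w) = trsObj A z v + 2 * t * (w ⬝ᵥ A *ᵥ v - w ⬝ᵥ z)
      + t ^ 2 * (w ⬝ᵥ A *ᵥ w) := by
  have h : v ⬝ᵥ A *ᵥ w = w ⬝ᵥ A *ᵥ v := by
    rw [dotProduct_mulVec, dotProduct_comm, ← mulVec_transpose, hA.eq]
  simp only [trsObj, mulVec_add, mulVec_smul, add_dotProduct, dotProduct_add, smul_dotProduct,
    dotProduct_smul, smul_eq_mul, h]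
  ring

/-- A point of the open ball is never a minimizer of the objective over the closed ball when the
largest eigenvalue of `A` is smaller than one and `z` lies on the sphere. -/
lemma exists_trsObj_lt_of_mem_ball {A : Matrix ι ι ℝ} (hA : A.IsSymm)
    (hpos : ∀ v, 0 ≤ v ⬝ᵥ A *ᵥ v) {c : ℝ} (hc : c < 1) (hle : ∀ v, v ⬝ᵥ A *ᵥ v ≤ c * (v ⬝ᵥ v))
    {z v : ι → ℝ} (hz : 0 < z ⬝ᵥ z) (hv : v ⬝ᵥ v < z ⬝ᵥ z) :
    ∃ w, w ⬝ᵥ w ≤ z ⬝ᵥ z ∧ trsObj A z w < trsObj A z v := by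
  have hcz := (hpos z).trans (hle z)
  have hc0 : 0 ≤ c := nonneg_of_mul_nonneg_left hcz hz
  have hslope : z ⬝ᵥ A *ᵥ v - z ⬝ᵥ z ≤ (c - 1) * (z ⬝ᵥ z) := by
    have h := hpos (v + (-1 : ℝ) • z)
    have e := trsObj_add_smul hA 0 v z (-1)
    simp only [trsObj, dotProduct_zero, mul_zero, sub_zero] at e
    rw [e] at h
    nlinarith [hle z, hle v]
  have hcont : ContinuousAt (fun t : ℝ => (v + t • z) ⬝ᵥ (v + t • z)) 0 := by
    simp only [dotProduct]
    fun_prop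
  have hev : ∀ᶠ t : ℝ in nhdsWithin 0 (Set.Ioi 0),
      (v + t • z) ⬝ᵥ (v + t • z) < z ⬝ᵥ z ∧ t < 1 - c ∧ 0 < t := by
    refine Filter.Eventually.and ?_ (Filter.Eventually.and ?_ self_mem_nhdsWithin)
    · exact (hcont.eventually_lt continuousAt_const (by simpa using hv)).filter_mono
        nhdsWithin_le_nhds
    · exact (eventually_lt_nhds (by linarith)).filter_mono nhdsWithin_le_nhds
  obtain ⟨t, h1, h2, h3⟩ := hev.exists
  refine ⟨v + t • z, h1.le, ?_⟩
  rw [trsObj_add_smul hA]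
  have h4 : t ^ 2 * (z ⬝ᵥ A *ᵥ z) ≤ t ^ 2 * (c * (z ⬝ᵥ z)) := by gcongr; exact hle z
  have h5 : 2 * t * (z ⬝ᵥ A *ᵥ v - z ⬝ᵥ z) ≤ 2 * t * ((c - 1) * (z ⬝ᵥ z)) := by gcongr
  have h6 : t * c * (t * (z ⬝ᵥ z)) ≤ (1 - c) * (t * (z ⬝ᵥ z)) := by
    apply mul_le_mul_of_nonneg_right _ (by positivity)
    nlinarith
  have h7 : 0 < (1 - c) * (t * (z ⬝ᵥ z)) := by
    have : 0 < 1 - c := by linarith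
    positivity
  nlinarith

lemma exists_isMinOn_trsObj_ball (A : Matrix ι ι ℝ) (z : ι → ℝ) :
    ∃ g, g ⬝ᵥ g ≤ z ⬝ᵥ z ∧ ∀ w, w ⬝ᵥ w ≤ z ⬝ᵥ z → trsObj A z g ≤ trsObj A z w := by
  have hsub : {v : ι → ℝ | v ⬝ᵥ v ≤ z ⬝ᵥ z} ⊆ Metric.closedBall 0 (Real.sqrt (z ⬝ᵥ z)) := by
    intro v hv
    rw [mem_closedBall_zero_iff, pi_norm_le_iff_of_nonneg (Real.sqrt_nonneg _)]
    intro i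
    rw [Real.norm_eq_abs]
    apply Real.abs_le_sqrt
    refine le_trans ?_ hv
    rw [sq]
    exact Finset.single_le_sum (f := fun i => v i * v i) (fun j _ => mul_self_nonneg _)
      (Finset.mem_univ i)
  have hclosed : IsClosed {v : ι → ℝ | v ⬝ᵥ v ≤ z ⬝ᵥ z} := by
    refine isClosed_le ?_ continuous_const
    simp only [dotProduct]
    fun_prop
  have hcomp : IsCompact {v : ι → ℝ | v ⬝ᵥ v ≤ z ⬝ᵥ z} :=
    (isCompact_closedBall _ _).of_isClosed_subset hclosed hsub
  have hcont : Continuous (trsObj A z) := by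
    unfold trsObj
    simp only [dotProduct, mulVec]
    fun_prop
  obtain ⟨g, hg, hmin⟩ := hcomp.exists_isMinOn ⟨z, le_refl (z ⬝ᵥ z)⟩ hcont.continuousOn
  exact ⟨g, hg, fun w hw => hmin hw⟩

/-- The trust-region subproblem with `0 ≤ A < 1` and `z` on the sphere has a unique minimizer. -/
theorem existsUnique_trs_minimizer {A : Matrix ι ι ℝ} (hA : A.IsSymm)
    (hpos : ∀ v, 0 ≤ v ⬝ᵥ A *ᵥ v) {c : ℝ} (hc : c < 1) (hle : ∀ v, v ⬝ᵥ A *ᵥ v ≤ c * (v ⬝ᵥ v))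
    {z : ι → ℝ} (hz : 0 < z ⬝ᵥ z) :
    ∃! g, g ⬝ᵥ g = z ⬝ᵥ z ∧ ∀ w, w ⬝ᵥ w = z ⬝ᵥ z → trsObj A z g ≤ trsObj A z w := by
  obtain ⟨g, hg, hmin⟩ := exists_isMinOn_trsObj_ball A z
  have hsphere : ∀ v, v ⬝ᵥ v ≤ z ⬝ᵥ z → trsObj A z v ≤ trsObj A z g → v ⬝ᵥ v = z ⬝ᵥ z := by
    intro v hv hvg
    refine hv.antisymm (not_lt.mp fun hlt => ?_)
    obtain ⟨w, hw, hwv⟩ := exists_trsObj_lt_of_mem_ball hA hpos hc hle hz hlt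
    linarith [hmin w hw]
  have hgz := hsphere g hg le_rfl
  refine ⟨g, ⟨hgz, fun w hw => hmin w hw.le⟩, ?_⟩
  rintro v ⟨hvz, hv⟩
  have hvg := hv g hgz
  have h0 : ∀ w t, trsObj A z (g + t • w) = _ := fun w t => trsObj_add_smul hA z g w t
  have hN : ∀ t : ℝ, (g + t • (v - g)) ⬝ᵥ (g + t • (v - g))
      = g ⬝ᵥ g + t * (v ⬝ᵥ v - g ⬝ᵥ g) + (t ^ 2 - t) * ((v - g) ⬝ᵥ (v - g)) := by
    intro t
    simp only [add_dotProduct, dotProduct_add, smul_dotProduct, dotProduct_smul, smul_eq_mul,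
      sub_dotProduct, dotProduct_sub, dotProduct_comm v g]
    ring
  have hnn : 0 ≤ (v - g) ⬝ᵥ (v - g) := by
    simpa using dotProduct_star_self_nonneg (v - g)
  have hmid : trsObj A z (g + (1 / 2 : ℝ) • (v - g)) ≤ trsObj A z g := by
    have h1 := h0 (v - g) 1
    have h2 := h0 (v - g) (1 / 2)
    rw [one_smul, add_sub_cancel] at h1
    rw [h2]
    linarith [hpos (v - g)]
  have hball := hN (1 / 2)
  have := hsphere _ (by rw [hball]; linarith) hmid
  have hzero : (v - g) ⬝ᵥ (v - g) = 0 := by linarith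
  exact sub_eq_zero.mp (dotProduct_self_eq_zero.mp hzero)

end Matrix

namespace ModOneMulti

open Matrix

variable {d m k : ℕ}

lemma adj_symm (i j : V d m) (h : adj d m k i j) : adj d m k j i :=
  ⟨h.1.symm, fun t => abs_sub_comm (i t : ℤ) (j t : ℤ) ▸ h.2 t⟩

/-- The proximity graph on the grid. -/
def gridGraph (d m k : ℕ) : SimpleGraph (V d m) where
  Adj := adj d m k
  symm := ⟨adj_symm⟩
  loopless := ⟨fun _ h => h.1 rfl⟩

instance gridGraphDec : DecidableRel (gridGraph d m k).Adj := fun i j => adjDec d m k i j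

lemma degree_gridGraph (i : V d m) : (gridGraph d m k).degree i = deg d m k i := by
  rw [← SimpleGraph.card_neighborFinset_eq_degree, deg]
  congr 1
  ext j
  rw [SimpleGraph.mem_neighborFinset, Finset.mem_filter_univ]
  rfl

lemma lap_eq_lapMatrix : lap d m k = (gridGraph d m k).lapMatrix ℝ := by
  ext i j
  rw [lap, SimpleGraph.lapMatrix, Matrix.sub_apply, SimpleGraph.degMatrix,
    SimpleGraph.adjMatrix_apply, Matrix.diagonal_apply, degree_gridGraph]
  by_cases h : i = j
  · subst h; simp
  · by_cases h' : adj d m k i j <;> simp [h, h', gridGraph]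

lemma deg_add_one_le (i : V d m) : deg d m k i + 1 ≤ (2 * k + 1) ^ d := by
  have hcard : (Fintype.piFinset fun t : Fin d =>
      Finset.Icc ((i t : ℤ) - k) ((i t : ℤ) + k)).card = (2 * k + 1) ^ d := by
    rw [Fintype.card_piFinset]
    simp only [Int.card_Icc]
    rw [Finset.prod_congr rfl (g := fun _ => 2 * k + 1) (fun t _ => by omega)]
    simp
  have hi : i ∉ Finset.univ.filter (adj d m k i) := by simp [adj]
  rw [deg, ← Finset.card_insert_of_notMem hi, ← hcard]
  refine Finset.card_le_card_of_injOn (fun j t => ((j t : ℕ) : ℤ)) ?_ ?_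
  · intro j hj
    simp only [Finset.coe_insert, Set.mem_insert_iff, Finset.mem_coe, Finset.mem_filter,
      Finset.mem_univ, true_and] at hj
    simp only [Finset.mem_coe, Fintype.mem_piFinset, Finset.mem_Icc]
    intro t
    rcases hj with rfl | hj
    · omega
    · have := abs_le.mp (hj.2 t)
      omega
  · intro j _ j' _ h
    funext t
    have := congrFun h t
    simp only [Nat.cast_inj] at this
    exact Fin.ext this

lemma dotProduct_lap_mulVec (v : V d m → ℝ) :
    v ⬝ᵥ lap d m k *ᵥ v = (∑ i, ∑ j, if adj d m k i j then (v i - v j) ^ 2 else 0) / 2 := by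
  rw [lap_eq_lapMatrix, ← Matrix.toLinearMap₂'_apply', SimpleGraph.lapMatrix_toLinearMap₂']
  rfl

lemma sum_adj_const (i : V d m) (a : ℝ) :
    (∑ j, if adj d m k i j then a else 0) = deg d m k i * a := by
  rw [← Finset.sum_filter, Finset.sum_const, nsmul_eq_mul, deg]

lemma cast_deg_le (i : V d m) : (deg d m k i : ℝ) ≤ (2 * (k : ℝ) + 1) ^ d - 1 := by
  have : ((deg d m k i + 1 : ℕ) : ℝ) ≤ (((2 * k + 1) ^ d : ℕ) : ℝ) :=
    Nat.cast_le.mpr (deg_add_one_le i)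
  push_cast at this
  linarith

lemma dotProduct_lap_mulVec_nonneg (v : V d m → ℝ) : 0 ≤ v ⬝ᵥ lap d m k *ᵥ v := by
  rw [dotProduct_lap_mulVec]
  have : ∀ i j, 0 ≤ if adj d m k i j then (v i - v j) ^ 2 else 0 := fun i j => by
    split_ifs <;> positivity
  exact div_nonneg (Finset.sum_nonneg fun i _ => Finset.sum_nonneg fun j _ => this i j) (by simp)

lemma dotProduct_lap_mulVec_le (v : V d m → ℝ) :
    v ⬝ᵥ lap d m k *ᵥ v ≤ 2 * ((2 * (k : ℝ) + 1) ^ d - 1) * (v ⬝ᵥ v) := by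
  have hterm : ∀ i j, (if adj d m k i j then (v i - v j) ^ 2 else 0) ≤
      (if adj d m k i j then 2 * v i ^ 2 else 0) + (if adj d m k j i then 2 * v j ^ 2 else 0) := by
    intro i j
    by_cases h : adj d m k i j
    · simp only [h, adj_symm i j h, if_true]
      nlinarith [sq_nonneg (v i + v j)]
    · have h' : ¬adj d m k j i := fun h' => h (adj_symm j i h')
      simp [h, h']
  have hsum : (∑ i, ∑ j, if adj d m k i j then (v i - v j) ^ 2 else 0) ≤
      ∑ i, 2 * (deg d m k i * (2 * v i ^ 2)) := by
    refine (Finset.sum_le_sum fun i _ => Finset.sum_le_sum fun j _ => hterm i j).trans ?_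
    simp only [Finset.sum_add_distrib]
    rw [Finset.sum_comm (f := fun i j => if adj d m k j i then 2 * v j ^ 2 else 0)]
    simp only [sum_adj_const, ← Finset.mul_sum]
    linarith
  rw [dotProduct_lap_mulVec, dotProduct, Finset.mul_sum, div_le_iff₀ two_pos, Finset.sum_mul]
  refine hsum.trans (Finset.sum_le_sum fun i _ => ?_)
  nlinarith [mul_le_mul_of_nonneg_right (cast_deg_le (k := k) i) (sq_nonneg (v i))]

lemma isSymm_Hmat (lam : ℝ) : (Hmat d m k lam).IsSymm := by
  have h : (lam • lap d m k).IsSymm := by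
    rw [lap_eq_lapMatrix]
    exact ((gridGraph d m k).isSymm_lapMatrix ℝ).smul _
  exact Matrix.IsSymm.fromBlocks h (by simp) h

lemma dotProduct_Hmat_mulVec (lam : ℝ) (v : V d m ⊕ V d m → ℝ) :
    v ⬝ᵥ Hmat d m k lam *ᵥ v =
      lam * ((v ∘ Sum.inl) ⬝ᵥ lap d m k *ᵥ (v ∘ Sum.inl)
        + (v ∘ Sum.inr) ⬝ᵥ lap d m k *ᵥ (v ∘ Sum.inr)) := by
  rw [Hmat, Matrix.fromBlocks_mulVec]
  simp only [dotProduct, Fintype.sum_sum_type, Sum.elim_inl, Sum.elim_inr, Matrix.zero_mulVec,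
    add_zero, zero_add, Matrix.smul_mulVec, Pi.smul_apply,
    smul_eq_mul, mul_add, Finset.mul_sum, Function.comp_apply]
  congr 1 <;> exact Finset.sum_congr rfl fun i _ => by ring

lemma dotProduct_sum_self (v : V d m ⊕ V d m → ℝ) :
    v ⬝ᵥ v = (v ∘ Sum.inl) ⬝ᵥ (v ∘ Sum.inl) + (v ∘ Sum.inr) ⬝ᵥ (v ∘ Sum.inr) := by
  simp [dotProduct, Fintype.sum_sum_type]

lemma circ_re (t : ℝ) : (circ t).re = Real.cos (2 * Real.pi * t) := by
  rw [circ, show (2 * Real.pi * Complex.I * t : ℂ) = ((2 * Real.pi * t : ℝ) : ℂ) * Complex.I by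
    push_cast; ring, Complex.exp_ofReal_mul_I_re]

lemma circ_im (t : ℝ) : (circ t).im = Real.sin (2 * Real.pi * t) := by
  rw [circ, show (2 * Real.pi * Complex.I * t : ℂ) = ((2 * Real.pi * t : ℝ) : ℂ) * Complex.I by
    push_cast; ring, Complex.exp_ofReal_mul_I_im]

lemma cvec_dotProduct_self (t : V d m → ℝ) : cvec d m t ⬝ᵥ cvec d m t = (m : ℝ) ^ d := by
  rw [dotProduct, Fintype.sum_sum_type, ← Finset.sum_add_distrib]
  simp only [cvec, embed, Sum.elim_inl, Sum.elim_inr, circ_re, circ_im, ← sq,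
    Real.cos_sq_add_sin_sq]
  simp

lemma circ_sub_sq_le (s t : ℝ) :
    ((circ s).re - (circ t).re) ^ 2 + ((circ s).im - (circ t).im) ^ 2 ≤
      4 * Real.pi ^ 2 * (s - t) ^ 2 := by
  simp only [circ_re, circ_im]
  have h := Real.one_sub_sq_div_two_le_cos (x := 2 * Real.pi * s - 2 * Real.pi * t)
  rw [Real.cos_sub] at h
  nlinarith [Real.sin_sq_add_cos_sq (2 * Real.pi * s), Real.sin_sq_add_cos_sq (2 * Real.pi * t)]

lemma gridPt_mem_Icc (hm : 2 ≤ m) (i : V d m) (t : Fin d) :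
    gridPt d m i t ∈ Set.Icc (0 : ℝ) 1 := by
  have h2 : (2 : ℝ) ≤ m := by exact_mod_cast hm
  have hi : ((i t : ℕ) : ℝ) + 1 ≤ m := by exact_mod_cast (i t).isLt
  refine ⟨div_nonneg (Nat.cast_nonneg _) (by linarith), ?_⟩
  rw [gridPt, div_le_one (by linarith)]
  linarith

/-- Adjacent grid points are at Euclidean distance at most `2kd/m`. -/
lemma enorm_gridPt_sub_le (hm : 2 ≤ m) {i j : V d m} (h : adj d m k i j) :
    enorm d (gridPt d m i - gridPt d m j) ≤ 2 * k * d / m := by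
  have h2 : (2 : ℝ) ≤ m := by exact_mod_cast hm
  have hcoord : ∀ t, ((gridPt d m i - gridPt d m j) t) ^ 2 ≤ (2 * k / m : ℝ) ^ 2 := by
    intro t
    have hk : |((i t : ℕ) : ℝ) - ((j t : ℕ) : ℝ)| ≤ k := by exact_mod_cast h.2 t
    rw [Pi.sub_apply, gridPt, gridPt, ← sub_div]
    refine sq_le_sq' ?_ ?_ <;> rw [abs_le] at hk
    · rw [← neg_div, div_le_div_iff₀ (by linarith) (by linarith)]
      nlinarith [hk.1, (Nat.cast_nonneg k : (0 : ℝ) ≤ k)]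
    · rw [div_le_div_iff₀ (by linarith) (by linarith)]
      nlinarith [hk.2, (Nat.cast_nonneg k : (0 : ℝ) ≤ k)]
  have hd : (d : ℝ) ≤ (d : ℝ) ^ 2 := by exact_mod_cast Nat.le_self_pow two_ne_zero d
  rw [enorm]
  refine Real.sqrt_le_iff.mpr ⟨by positivity, ?_⟩
  calc ∑ t, ((gridPt d m i - gridPt d m j) t) ^ 2 ≤ ∑ _t : Fin d, (2 * k / m : ℝ) ^ 2 :=
        Finset.sum_le_sum fun t _ => hcoord t
    _ = d * (2 * k / m : ℝ) ^ 2 := by simp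
    _ ≤ d ^ 2 * (2 * k / m : ℝ) ^ 2 := by gcongr
    _ = (2 * k * d / m) ^ 2 := by ring

/-- Smoothness of the clean signal: `h̄ᵀHh̄` is small when `f` is Hölder continuous. -/
lemma cvec_dotProduct_Hmat_mulVec_le {lam B : ℝ} (hlam : 0 ≤ lam) (hB : 0 ≤ B)
    (t : V d m → ℝ) (ht : ∀ i j, adj d m k i j → (t i - t j) ^ 2 ≤ B) :
    cvec d m t ⬝ᵥ Hmat d m k lam *ᵥ cvec d m t ≤
      lam * (2 * Real.pi ^ 2 * B * ((2 * (k : ℝ) + 1) ^ d - 1) * (m : ℝ) ^ d) := by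
  rw [dotProduct_Hmat_mulVec, dotProduct_lap_mulVec, dotProduct_lap_mulVec, ← add_div]
  refine mul_le_mul_of_nonneg_left ?_ hlam
  rw [div_le_iff₀ two_pos]
  simp only [← Finset.sum_add_distrib]
  have hterm : ∀ i j, ((if adj d m k i j then
        ((cvec d m t ∘ Sum.inl) i - (cvec d m t ∘ Sum.inl) j) ^ 2 else 0) +
      if adj d m k i j then ((cvec d m t ∘ Sum.inr) i - (cvec d m t ∘ Sum.inr) j) ^ 2 else 0) ≤
      if adj d m k i j then 4 * Real.pi ^ 2 * B else 0 := by
    intro i j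
    split_ifs with h
    · refine (circ_sub_sq_le (t i) (t j)).trans ?_
      gcongr
      exact ht i j h
    · simp
  have hrow : ∀ i : V d m, (∑ j, if adj d m k i j then 4 * Real.pi ^ 2 * B else 0) ≤
      ((2 * (k : ℝ) + 1) ^ d - 1) * (4 * Real.pi ^ 2 * B) := by
    intro i
    rw [sum_adj_const]
    have := cast_deg_le (k := k) i
    gcongr
  calc _ ≤ ∑ i : V d m, ((2 * (k : ℝ) + 1) ^ d - 1) * (4 * Real.pi ^ 2 * B) :=
        Finset.sum_le_sum fun i _ => (Finset.sum_le_sum fun j _ => hterm i j).trans (hrow i)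
    _ = _ := by simp; ring

end ModOneMulti

open Matrix in
open ModOneMulti in
/-- Assume `m ≥ 2`, `‖z̄ − h̄‖₂ ≤ δ√n` for some `δ ∈ [0,1]`, and
`λ < 1/(2((2k+1)^d − 1))`. Then (TRS) has a unique global minimizer `ĝ`, and it satisfies
`(1/n)⟨h̄, ĝ⟩ ≥ 1 − 3δ/2 − λπ²M²(2k)^{2α}·d^{2α}·((2k+1)^d − 1)/n^{2α/d}`, where `n = m^d`. -/
theorem statement19 (d m k : ℕ) (hd : 1 ≤ d) (hm : 2 ≤ m) (hk₁ : 1 ≤ k) (hk₂ : k ≤ m - 1)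
    (lam : ℝ) (hlam : 0 ≤ lam) (hlam' : lam < 1 / (2 * ((2 * (k:ℝ) + 1) ^ d - 1)))
    (f : (Fin d → ℝ) → ℝ) (M α : ℝ) (hM : 0 < M) (hα : α ∈ Set.Ioc (0:ℝ) 1)
    (hf : ∀ x y : Fin d → ℝ, (∀ t, x t ∈ Set.Icc (0:ℝ) 1) → (∀ t, y t ∈ Set.Icc (0:ℝ) 1) →
      |f x - f y| ≤ M * (enorm d (x - y)) ^ α)
    (y : V d m → ℝ) (hy : ∀ i, y i ∈ Set.Ico (0:ℝ) 1)
    (δ : ℝ) (hδ : δ ∈ Set.Icc (0:ℝ) 1)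
    (hnoise : norm2 d m (cvec d m y - cvec d m (fun i => f (gridPt d m i))) ≤
      δ * Real.sqrt ((m:ℝ) ^ d)) :
    ∃ g, minimizer d m k lam (cvec d m y) g ∧
      (∀ g', minimizer d m k lam (cvec d m y) g' → g' = g) ∧
      (1 / ((m:ℝ)) ^ d) * dotR d m (cvec d m (fun i => f (gridPt d m i))) g ≥
        1 - 3 * δ / 2
          - lam * Real.pi ^ 2 * M ^ 2 * (2 * (k:ℝ)) ^ (2 * α) * (d:ℝ) ^ (2 * α)
              * ((2 * (k:ℝ) + 1) ^ d - 1) / ((m:ℝ) ^ d) ^ (2 * α / (d:ℝ)) := by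
  have h2 : (2 : ℝ) ≤ m := by exact_mod_cast hm
  have hm0 : (0 : ℝ) < m := by linarith
  have hn : (0 : ℝ) < (m : ℝ) ^ d := by positivity
  set D : ℝ := (2 * (k : ℝ) + 1) ^ d - 1
  set h := cvec d m (fun i => f (gridPt d m i))
  set z := cvec d m y
  have hDpos : 0 < D := sub_pos.mpr (one_lt_pow₀ (by
    have : (1 : ℝ) ≤ k := by exact_mod_cast hk₁
    linarith) (by omega))
  have hzz : z ⬝ᵥ z = (m : ℝ) ^ d := cvec_dotProduct_self y
  have hhh : h ⬝ᵥ h = (m : ℝ) ^ d := cvec_dotProduct_self _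
  have hpos : ∀ v, 0 ≤ v ⬝ᵥ Hmat d m k lam *ᵥ v := fun v => by
    rw [dotProduct_Hmat_mulVec]
    exact mul_nonneg hlam (add_nonneg (dotProduct_lap_mulVec_nonneg _)
      (dotProduct_lap_mulVec_nonneg _))
  have hle : ∀ v, v ⬝ᵥ Hmat d m k lam *ᵥ v ≤ lam * (2 * D) * (v ⬝ᵥ v) := fun v => by
    rw [dotProduct_Hmat_mulVec, mul_assoc, dotProduct_sum_self, mul_add (2 * D)]
    exact mul_le_mul_of_nonneg_left (add_le_add (dotProduct_lap_mulVec_le _)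
      (dotProduct_lap_mulVec_le _)) hlam
  have hc : lam * (2 * D) < 1 := (lt_div_iff₀ (by positivity)).mp hlam'
  have hmin : ∀ g, minimizer d m k lam z g ↔ g ⬝ᵥ g = z ⬝ᵥ z ∧ ∀ w, w ⬝ᵥ w = z ⬝ᵥ z →
      Matrix.trsObj (Hmat d m k lam) z g ≤ Matrix.trsObj (Hmat d m k lam) z w := fun g => by
    rw [hzz]
    simp only [minimizer, feasible, dotProduct, sq]
    rfl
  obtain ⟨g, hg, huniq⟩ := Matrix.existsUnique_trs_minimizer (isSymm_Hmat lam) hpos hc hle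
    (hzz ▸ hn : 0 < z ⬝ᵥ z)
  refine ⟨g, (hmin g).mpr hg, fun g' hg' => huniq g' ((hmin g').mp hg'), ?_⟩
  obtain ⟨hgz, hgmin⟩ := hg
  have hdist : (z - h) ⬝ᵥ (z - h) ≤ δ ^ 2 * (m : ℝ) ^ d := by
    have hsq := pow_le_pow_left₀ (Real.sqrt_nonneg _) hnoise 2
    rw [mul_pow, Real.sq_sqrt hn.le,
      Real.sq_sqrt (Finset.sum_nonneg fun _ _ => sq_nonneg _)] at hsq
    simpa only [dotProduct, ← sq] using hsq
  have hzh : (z - h) ⬝ᵥ (z - h) = 2 * (m : ℝ) ^ d - 2 * (h ⬝ᵥ z) := by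
    simp only [sub_dotProduct, dotProduct_sub, hzz, hhh, dotProduct_comm z h]
    ring
  have hgcs : (z - h) ⬝ᵥ g ≤ δ * (m : ℝ) ^ d := by
    have hcs : ((z - h) ⬝ᵥ g) ^ 2 ≤ ((z - h) ⬝ᵥ (z - h)) * (g ⬝ᵥ g) := by
      simpa only [dotProduct, ← sq] using Finset.sum_mul_sq_le_sq_mul_sq Finset.univ (z - h) g
    refine abs_le_of_sq_le_sq' ?_ (mul_nonneg hδ.1 hn.le) |>.2
    rw [hgz, hzz] at hcs
    nlinarith
  have hobj := hgmin h (hhh.trans hzz.symm)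
  simp only [Matrix.trsObj] at hobj
  have hquad := cvec_dotProduct_Hmat_mulVec_le (k := k)
    (B := M ^ 2 * ((2 * k * d / m : ℝ) ^ α) ^ 2) hlam (by positivity)
    (fun i => f (gridPt d m i)) (fun i j hij => by
      rw [← mul_pow]
      refine sq_le_sq.mpr ?_
      rw [abs_of_nonneg (by positivity : 0 ≤ M * (2 * k * d / m : ℝ) ^ α)]
      refine (hf _ _ (gridPt_mem_Icc hm i) (gridPt_mem_Icc hm j)).trans ?_
      exact mul_le_mul_of_nonneg_left (Real.rpow_le_rpow (Real.sqrt_nonneg _)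
        (enorm_gridPt_sub_le hm hij) hα.1.le) hM.le)
  have hpow : ((2 * k * d / m : ℝ) ^ α) ^ 2 =
      (2 * (k : ℝ)) ^ (2 * α) * (d : ℝ) ^ (2 * α) / ((m : ℝ) ^ d) ^ (2 * α / (d : ℝ)) := by
    have hd0 : (d : ℝ) ≠ 0 := by positivity
    rw [← Real.rpow_mul_natCast (by positivity), mul_comm α, Real.div_rpow (by positivity) hm0.le,
      Real.mul_rpow (by positivity) (by positivity), ← Real.rpow_natCast_mul hm0.le,
      mul_div_cancel₀ _ hd0]
    norm_num
  rw [hpow] at hquad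
  have hδ2 : δ ^ 2 ≤ δ := by nlinarith [hδ.1, hδ.2]
  have hexp : (z - h) ⬝ᵥ g = g ⬝ᵥ z - h ⬝ᵥ g := by
    rw [sub_dotProduct, dotProduct_comm z g]
  have hgH := hpos g
  change _ ≤ (1 / (m : ℝ) ^ d) * (h ⬝ᵥ g)
  rw [one_div, ← div_eq_inv_mul, le_div_iff₀ hn]
  have hδn : δ ^ 2 * (m : ℝ) ^ d ≤ δ * (m : ℝ) ^ d := mul_le_mul_of_nonneg_right hδ2 hn.le
  have hR : lam * (2 * Real.pi ^ 2 * (M ^ 2 * ((2 * (k : ℝ)) ^ (2 * α) * (d : ℝ) ^ (2 * α) /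
      ((m : ℝ) ^ d) ^ (2 * α / (d : ℝ)))) * D * (m : ℝ) ^ d) =
      2 * (lam * Real.pi ^ 2 * M ^ 2 * (2 * (k : ℝ)) ^ (2 * α) * (d : ℝ) ^ (2 * α) * D /
        ((m : ℝ) ^ d) ^ (2 * α / (d : ℝ)) * (m : ℝ) ^ d) := by ring
  rw [hR] at hquad
  rw [sub_mul, sub_mul]
  linarith
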